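/- For every d < ω there exist J = J(d) < ω and k = k(d) < ω such that the following holds. Let A be a finite nonempty set, let 𝓒 be a nonempty family of subsets of A of VC dimension at most d, and let C* ∈ 𝓒. Then there exist m with 1 ≤ m ≤ J and C_0, …, C_{m−1} ∈ 𝓒 such that: (i) each C_t is k-isolated in 𝓒, i.e. there is A_t ⊆ A with |A_t| ≤ k such that every C' ∈ 𝓒 with C' ∩ A_t = C_t ∩ A_t equals C_t; and (ii) for every a ∈ A, the number of t < m with (a ∈ C*) ⟺ (a ∈ C_t) is strictly greater than m/2 (equivalently, membership of a in C* equals the majority vote of the memberships of a in C_0, …, C_{m−1}). -/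

import Mathlib

/-- A family of subsets `F` of `X` shatters `B` if every subset of `B` is cut out by a
member of `F`. -/
def SetShatters {X : Type*} (F : Set (Set X)) (B : Set X) : Prop :=
  ∀ S ⊆ B, ∃ f ∈ F, f ∩ B = S

/-- The VC dimension of the family `F` is at most `n`: no finite set of size `> n` is
shattered by `F`. -/
def VCDimLE {X : Type*} (F : Set (Set X)) (n : ℕ) : Prop :=
  ∀ B : Finset X, SetShatters F ↑B → B.card ≤ n

/-! ### Families of bounded VC dimension -/

theorem SetShatters.mono {X : Type*} {F G : Set (Set X)} {B : Set X} (h : SetShatters F B)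
    (hFG : F ⊆ G) : SetShatters G B := fun S hS ↦ by
  obtain ⟨f, hf, hfS⟩ := h S hS
  exact ⟨f, hFG hf, hfS⟩

theorem VCDimLE.mono {X : Type*} {F G : Set (Set X)} {n : ℕ} (h : VCDimLE G n) (hFG : F ⊆ G) :
    VCDimLE F n := fun B hB ↦ h B (hB.mono hFG)

theorem VCDimLE.symmDiff_right {X : Type*} {F : Set (Set X)} {n : ℕ} (h : VCDimLE F n) (D : Set X) :
    VCDimLE ((fun C ↦ symmDiff C D) '' F) n := by
  intro B hB
  refine h B fun S hS ↦ ?_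
  obtain ⟨_, ⟨C, hC, rfl⟩, hCS⟩ := hB (symmDiff S (D ∩ B))
    (by intro x; simp only [Set.mem_symmDiff]; rintro (h | h)
        · exact hS h.1
        · exact h.1.2)
  refine ⟨C, hC, ?_⟩
  ext x
  have := Set.ext_iff.1 hCS x
  have := @hS x
  simp only [Set.mem_symmDiff, Set.mem_inter_iff] at *
  tauto

theorem VCDimLE.preimage {X Y : Type*} {F : Set (Set X)} {n : ℕ} (h : VCDimLE F n) (u : Y → X) :
    VCDimLE ((fun C ↦ u ⁻¹' C) '' F) n := by
  classical
  intro B hB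
  have hinj : Set.InjOn u B := by
    intro x hx y hy hxy
    obtain ⟨_, ⟨C, -, rfl⟩, hC⟩ := hB {x} (by simpa using hx)
    have h1 : x ∈ u ⁻¹' C ∩ B := by rw [hC]; rfl
    have h2 : y ∈ u ⁻¹' C ∩ B := ⟨by simpa [← hxy] using h1.1, hy⟩
    rw [hC] at h2
    exact h2.symm
  rw [← Finset.card_image_of_injOn hinj]
  refine h _ fun S hS ↦ ?_
  obtain ⟨_, ⟨C, hC, rfl⟩, hCS⟩ := hB (u ⁻¹' S ∩ B) Set.inter_subset_right
  refine ⟨C, hC, ?_⟩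
  ext x
  constructor
  · rintro ⟨hx, hxB⟩
    obtain ⟨y, hy, rfl⟩ := by simpa using hxB
    have : y ∈ u ⁻¹' C ∩ B := ⟨hx, hy⟩
    rw [hCS] at this
    exact this.1
  · intro hx
    refine ⟨?_, hS hx⟩
    obtain ⟨y, hy, rfl⟩ := by simpa using hS hx
    have : y ∈ u ⁻¹' S ∩ B := ⟨hx, hy⟩
    rw [← hCS] at this
    exact this.1

/-- The dual family of a family of VC dimension at most `d` has VC dimension at most
`2 ^ (d + 1)`. -/
theorem VCDimLE.dual {X ι : Type*} {F : Set (Set X)} {d : ℕ} (h : VCDimLE F d) (C : ι → Set X)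
    (hC : ∀ t, C t ∈ F) : VCDimLE (Set.range fun a ↦ {t | a ∈ C t}) (2 ^ (d + 1)) := by
  classical
  intro B hB
  by_contra! hcard
  have hle : Fintype.card (Finset (Fin (d + 1))) ≤ Fintype.card B := by simpa using hcard.le
  obtain ⟨g⟩ := Function.Embedding.nonempty_of_card_le hle
  have hex : ∀ i : Fin (d + 1), ∃ a, ∀ P, a ∈ C (g P) ↔ i ∈ P := by
    intro i
    obtain ⟨_, ⟨a, rfl⟩, ha⟩ := hB {t | ∃ P, (g P : ι) = t ∧ i ∈ P}
      (by rintro _ ⟨P, rfl, -⟩; exact (g P).2)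
    refine ⟨a, fun P ↦ ?_⟩
    have := Set.ext_iff.1 ha (g P)
    simpa using this
  choose a ha using hex
  have hinj : Function.Injective a := by
    intro i j hij
    have := (ha i {j}).symm.trans (hij ▸ ha j {j})
    simpa using this
  have := h (Finset.univ.map ⟨a, hinj⟩) fun S hS ↦ ?_
  · simp at this
  refine ⟨C (g {i | a i ∈ S}), hC _, ?_⟩
  ext x
  constructor
  · rintro ⟨hx, hxB⟩
    obtain ⟨i, rfl⟩ := by simpa using hxB
    simpa [ha] using hx
  · intro hx
    refine ⟨?_, hS hx⟩
    obtain ⟨i, rfl⟩ := by simpa using hS hx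
    simpa [ha] using hx

/-- The **Sauer–Shelah lemma**, with a polynomial bound. -/
theorem VCDimLE.ncard_le {κ : Type*} [Fintype κ] {F : Set (Set κ)} {D : ℕ} (h : VCDimLE F D) :
    F.ncard ≤ (Fintype.card κ + 1) ^ D := by
  classical
  let 𝒜 : Finset (Finset κ) := {s | (s : Set κ) ∈ F}
  have hF : F = (fun s : Finset κ ↦ (s : Set κ)) '' (𝒜 : Set (Finset κ)) := by
    ext S
    constructor
    · intro hS
      exact ⟨S.toFinset, by simpa [𝒜] using hS, by simp⟩
    · rintro ⟨s, hs, rfl⟩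
      simpa [𝒜] using hs
  have hvc : 𝒜.vcDim ≤ D := by
    refine Finset.sup_le fun s hs ↦ h s fun S hS ↦ ?_
    obtain ⟨u, hu, hsu⟩ := (Finset.mem_shatterer.1 hs) (t := S.toFinset)
      (by intro x hx; exact hS (by simpa using hx))
    refine ⟨u, by simpa [𝒜] using hu, ?_⟩
    have := congrArg (fun s : Finset κ ↦ (s : Set κ)) hsu
    simpa [Set.inter_comm] using this
  calc F.ncard ≤ 𝒜.card := by
        rw [hF, ← Set.ncard_coe_finset 𝒜]
        exact Set.ncard_image_le
    _ ≤ ∑ k ∈ Finset.Iic 𝒜.vcDim, (Fintype.card κ).choose k :=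
        𝒜.card_le_card_shatterer.trans Finset.card_shatterer_le_sum_vcDim
    _ ≤ ∑ k ∈ Finset.Iic D, (Fintype.card κ).choose k :=
        Finset.sum_le_sum_of_subset (Finset.Iic_subset_Iic.2 hvc)
    _ = ∑ k ∈ Finset.range (D + 1), (Fintype.card κ).choose k := by
        congr 1; ext; simp
    _ ≤ ∑ k ∈ Finset.range (D + 1), (Fintype.card κ) ^ k * 1 ^ (D - k) * D.choose k := by
        refine Finset.sum_le_sum fun k hk ↦ ?_
        have hk : k ≤ D := by simpa [Nat.lt_succ_iff] using hk
        rw [one_pow, mul_one]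
        exact (Nat.choose_le_pow _ _).trans (Nat.le_mul_of_pos_right _ (Nat.choose_pos hk))
    _ = (Fintype.card κ + 1) ^ D := (add_pow _ _ _).symm

theorem VCDimLE.ncard_preimage_le {X κ : Type*} [Fintype κ] {F : Set (Set X)} {D : ℕ}
    (h : VCDimLE F D) (u : κ → X) :
    ((fun C ↦ u ⁻¹' C) '' F).ncard ≤ (Fintype.card κ + 1) ^ D :=
  (h.preimage u).ncard_le

/-! ### Isolated members -/

/-- `C` is `k`-isolated in `F`. -/
def IsIsolatedIn {A : Type*} (F : Set (Set A)) (k : ℕ) (C : Set A) : Prop :=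
  ∃ A₀ : Finset A, A₀.card ≤ k ∧ ∀ C' ∈ F, C' ∩ ↑A₀ = C ∩ ↑A₀ → C' = C

/-- If `C` is `k`-isolated among the members of `F` agreeing with `D` on `Y`, and itself agrees
with `D` on `Y`, then it is `(Y.card + k)`-isolated in `F`. -/
theorem IsIsolatedIn.of_agreeing {A : Type*} {F : Set (Set A)} {k : ℕ} {C D : Set A}
    {Y : Finset A} (h : IsIsolatedIn {C' ∈ F | ∀ y ∈ Y, y ∈ C' ↔ y ∈ D} k C)
    (hC : ∀ y ∈ Y, y ∈ C ↔ y ∈ D) : IsIsolatedIn F (Y.card + k) C := by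
  classical
  obtain ⟨A₀, hA₀, hiso⟩ := h
  refine ⟨Y ∪ A₀, (Finset.card_union_le _ _).trans (by lia), fun C' hC' heq ↦ ?_⟩
  have key : ∀ x, x ∈ Y ∨ x ∈ A₀ → (x ∈ C' ↔ x ∈ C) := by
    intro x hx
    have := Set.ext_iff.1 heq x
    simp only [Finset.coe_union, Set.mem_inter_iff, Set.mem_union, Finset.mem_coe] at this
    tauto
  refine hiso C' ⟨hC', fun y hy ↦ (key y (Or.inl hy)).trans (hC y hy)⟩ ?_
  ext x
  have := key x
  simp only [Set.mem_inter_iff, Finset.mem_coe]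
  tauto

/-- Fixing a suitable pattern on boundedly many points lowers the VC dimension. -/
theorem exists_vcDimLE_agreeing {A : Type*} [Fintype A] {F : Set (Set A)} {d : ℕ}
    (hne : F.Nonempty) (h : VCDimLE F (d + 1)) :
    ∃ (Y : Finset A) (C : Set A), Y.card ≤ 2 ^ (d + 1) * d + d + 1 ∧ C ∈ F ∧
      VCDimLE {C' ∈ F | ∀ y ∈ Y, y ∈ C' ↔ y ∈ C} d := by
  classical
  set k := 2 ^ (d + 1) * d + d + 1 with hk
  let G : Finset A × Set A → Set (Set A) := fun p ↦ {C' ∈ F | ∀ y ∈ p.1, y ∈ C' ↔ y ∈ p.2}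
  obtain ⟨C₀, hC₀⟩ := hne
  obtain ⟨⟨Y, C⟩, ⟨hY, hC⟩, hmin⟩ := Set.exists_min_image
    {p : Finset A × Set A | p.1.card ≤ k ∧ p.2 ∈ F} (fun p ↦ (G p).ncard) (Set.toFinite _)
    ⟨(∅, C₀), by simp, hC₀⟩
  simp only at hY hC
  refine ⟨Y, C, hY, hC, fun X hX ↦ ?_⟩
  by_contra! hXd
  have hXcard : X.card = d + 1 :=
    le_antisymm (h X (hX.mono (Set.sep_subset _ _))) hXd
  have hreal : ∀ S ⊆ X, ∃ C' ∈ G (Y, C), ∀ x ∈ X, x ∈ C' ↔ x ∈ S := by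
    intro S hS
    obtain ⟨C', hC', heq⟩ := hX S (by exact_mod_cast hS)
    refine ⟨C', hC', fun x hx ↦ ?_⟩
    have := Set.ext_iff.1 heq x
    simpa [hx] using this
  let H : Finset A → Finset A := fun S ↦
    {y ∈ Y | ∃ C' ∈ F, (∀ x ∈ X, x ∈ C' ↔ x ∈ S) ∧ ¬ (y ∈ C' ↔ y ∈ C)}
  have hH : ∀ S ∈ X.powerset, k < (H S).card + (d + 1) := by
    intro S hS
    rw [Finset.mem_powerset] at hS
    by_contra! hle
    obtain ⟨C₁, hC₁, hC₁S⟩ := hreal S hS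
    have hsub : G (H S ∪ X, C₁) ⊂ G (Y, C) := by
      rw [Set.ssubset_iff_exists]
      constructor
      · rintro C' ⟨hC', hag⟩
        have hC'S : ∀ x ∈ X, x ∈ C' ↔ x ∈ S := fun x hx ↦
          (hag x (Finset.mem_union_right _ hx)).trans (hC₁S x hx)
        refine ⟨hC', fun y hy ↦ ?_⟩
        by_cases hyH : y ∈ H S
        · exact (hag y (Finset.mem_union_left _ hyH)).trans (hC₁.2 y hy)
        · by_contra hne
          exact hyH (Finset.mem_filter.2 ⟨hy, C', hC', hC'S, hne⟩)
      · obtain ⟨C₂, hC₂, hC₂S⟩ := hreal (X \ S) Finset.sdiff_subset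
        refine ⟨C₂, hC₂, fun hC₂' ↦ ?_⟩
        obtain ⟨x, hx⟩ : X.Nonempty := Finset.card_pos.1 (by lia)
        have h1 := hC₂S x hx
        have h2 := hC₁S x hx
        have h3 := hC₂'.2 x (Finset.mem_union_right _ hx)
        simp only [Finset.mem_sdiff] at h1
        simp only at h3
        tauto
    have h1 := Set.ncard_lt_ncard hsub (Set.toFinite _)
    have h2 := hmin (H S ∪ X, C₁)
      ⟨(Finset.card_union_le _ _).trans (by simpa [hXcard] using hle), hC₁.1⟩
    exact absurd h2 (not_le.2 h1)
  obtain ⟨y, hyY, hy⟩ : ∃ y ∈ Y, ∀ S ∈ X.powerset, y ∈ H S := by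
    by_contra! hcon
    have hsub : Y ⊆ X.powerset.biUnion fun S ↦ Y \ H S := by
      intro y hy
      obtain ⟨S, hS, hyS⟩ := hcon y hy
      exact Finset.mem_biUnion.2 ⟨S, hS, Finset.mem_sdiff.2 ⟨hy, hyS⟩⟩
    have h1 := (Finset.card_le_card hsub).trans
      (Finset.card_biUnion_le_card_mul _ _ d fun S hS ↦ by
        have h2 := hH S hS
        have h3 : H S ⊆ Y := Finset.filter_subset _ _
        have h4 := Finset.card_sdiff_add_card_eq_card h3
        lia)
    rw [Finset.card_powerset, hXcard] at h1
    have h2 := hH ∅ (Finset.empty_mem_powerset _)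
    have h3 : (H ∅).card ≤ Y.card := Finset.card_le_card (Finset.filter_subset _ _)
    lia
  have hyX : y ∉ X := by
    intro hyX
    obtain ⟨C₁, hC₁, hC₁S⟩ := hreal ∅ (Finset.empty_subset _)
    obtain ⟨C₂, hC₂, hC₂S⟩ := hreal X subset_rfl
    have h1 := hC₁S y hyX
    have h2 := hC₂S y hyX
    have h3 := hC₁.2 y hyY
    have h4 := hC₂.2 y hyY
    simp only [Finset.notMem_empty] at h1
    tauto
  have hsh : SetShatters F ↑(insert y X) := by
    intro T hT
    set S : Finset A := {x ∈ X | x ∈ T} with hS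
    have hSX : S ⊆ X := Finset.filter_subset _ _
    obtain ⟨C', hC', hC'S, hC'y⟩ : ∃ C' ∈ F, (∀ x ∈ X, x ∈ C' ↔ x ∈ S) ∧ (y ∈ C' ↔ y ∈ T) := by
      obtain ⟨C₁, hC₁, hC₁S⟩ := hreal S hSX
      obtain ⟨-, C₂, hC₂, hC₂S, hC₂y⟩ := Finset.mem_filter.1 (hy S (Finset.mem_powerset.2 hSX))
      by_cases hyT : y ∈ C ↔ y ∈ T
      · exact ⟨C₁, hC₁.1, hC₁S, (hC₁.2 y hyY).trans hyT⟩
      · exact ⟨C₂, hC₂, hC₂S, by tauto⟩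
    refine ⟨C', hC', ?_⟩
    ext x
    have h1 := @hT x
    have h2 := hC'S x
    simp only [hS, Finset.mem_filter] at h2
    simp only [Finset.coe_insert, Set.mem_insert_iff, Finset.mem_coe, Set.mem_inter_iff] at h1 ⊢
    by_cases hxy : x = y
    · subst hxy; tauto
    · tauto
  have := h _ hsh
  rw [Finset.card_insert_of_notMem hyX] at this
  lia

universe u

/-- A finite nonempty family of VC dimension at most `d` has a member that is `k`-isolated,
with `k` depending only on `d`. -/
theorem exists_isIsolatedIn (d : ℕ) : ∃ k : ℕ, ∀ (A : Type u) [Fintype A] (F : Set (Set A)),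
    F.Nonempty → VCDimLE F d → ∃ C ∈ F, IsIsolatedIn F k C := by
  induction d with
  | zero =>
    refine ⟨0, fun A _ F hne h ↦ ?_⟩
    obtain ⟨C, hC⟩ := hne
    refine ⟨C, hC, ∅, by simp, fun C' hC' _ ↦ ?_⟩
    by_contra hne
    obtain ⟨x, hx⟩ : ∃ x, ¬ (x ∈ C' ↔ x ∈ C) := by
      by_contra! hcon
      exact hne (Set.ext hcon)
    have := h {x} fun S hS ↦ ?_
    · simp at this
    obtain ⟨D, hD, hDx⟩ : ∃ D ∈ F, x ∈ D ↔ x ∈ S := by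
      by_cases hxS : x ∈ C ↔ x ∈ S
      · exact ⟨C, hC, hxS⟩
      · exact ⟨C', hC', by tauto⟩
    refine ⟨D, hD, ?_⟩
    ext z
    have := @hS z
    simp only [Finset.coe_singleton, Set.mem_singleton_iff, Set.mem_inter_iff] at this ⊢
    constructor
    · rintro ⟨hz, rfl⟩; exact hDx.1 hz
    · intro hz
      obtain rfl := this hz
      exact ⟨hDx.2 hz, rfl⟩
  | succ d ih =>
    obtain ⟨k, hk⟩ := ih
    refine ⟨2 ^ (d + 1) * d + d + 1 + k, fun A _ F hne h ↦ ?_⟩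
    obtain ⟨Y, D, hY, hD, hvc⟩ := exists_vcDimLE_agreeing hne h
    obtain ⟨C, hC, hiso⟩ := hk A {C ∈ F | ∀ y ∈ Y, y ∈ C ↔ y ∈ D}
      ⟨D, hD, fun _ _ ↦ Iff.rfl⟩ hvc
    obtain ⟨A₀, hA₀, hA₀'⟩ := hiso.of_agreeing hC.2
    exact ⟨C, hC.1, A₀, by lia, hA₀'⟩

/-! ### Double sampling -/

theorem card_filter_apply_mem {κ V : Type*} [Fintype κ] [DecidableEq κ] [Fintype V] (R : Set V)
    [DecidablePred (· ∈ R)] (i : κ) :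
    ({s : κ → V | s i ∈ R} : Finset (κ → V)).card * Fintype.card V
      = R.ncard * Fintype.card V ^ Fintype.card κ := by
  classical
  let T : κ → Finset V := fun j ↦ if j = i then R.toFinset else Finset.univ
  have hT : ({s : κ → V | s i ∈ R} : Finset (κ → V)) = Fintype.piFinset T := by
    ext s
    simp only [Finset.mem_filter, Finset.mem_univ, true_and, Fintype.mem_piFinset, T]
    constructor
    · intro hs j
      split_ifs with hj
      · subst hj; simpa using hs
      · simp
    · intro hs
      simpa using hs i
  rw [hT, Fintype.card_piFinset, ← Finset.mul_prod_erase _ _ (Finset.mem_univ i),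
    Finset.prod_congr rfl (g := fun _ ↦ Fintype.card V)
      (fun j hj ↦ by simp [T, Finset.ne_of_mem_erase hj]),
    Finset.prod_const, Finset.card_erase_of_mem (Finset.mem_univ i), Finset.card_univ, mul_assoc,
    pow_sub_one_mul (Fintype.card_pos_iff.2 ⟨i⟩).ne']
  simp [T, Set.ncard_eq_toFinset_card']

/-- If `R` is a set of density at most `1 / (2 * n)`, then at least half of the `n`-tuples
avoid `R`. -/
theorem card_pow_le_two_mul_card_avoiding {κ V : Type*} [Fintype κ] [DecidableEq κ] [Fintype V]
    (R : Set V) [DecidablePred (· ∈ R)] (hR : 2 * Fintype.card κ * R.ncard ≤ Fintype.card V) :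
    Fintype.card V ^ Fintype.card κ
      ≤ 2 * ({s : κ → V | ∀ i, s i ∉ R} : Finset (κ → V)).card := by
  classical
  rcases Nat.eq_zero_or_pos (Fintype.card V) with h0 | hpos
  · have : R = ∅ := by
      have := Fintype.card_eq_zero_iff.1 h0
      exact Set.eq_empty_of_isEmpty R
    subst this
    simp only [Set.mem_empty_iff_false, not_false_eq_true, implies_true, Finset.filter_true,
      Finset.card_univ, Fintype.card_fun]
    lia
  have hsub : (Finset.univ : Finset (κ → V)) ⊆ ({s : κ → V | ∀ i, s i ∉ R} : Finset (κ → V)) ∪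
      Finset.univ.biUnion fun i : κ ↦ ({s : κ → V | s i ∈ R} : Finset (κ → V)) := by
    intro s _
    by_cases hs : ∀ i, s i ∉ R
    · simp [hs]
    · simp only [not_forall, not_not] at hs
      simp [hs]
  have h1 := (Finset.card_le_card hsub).trans ((Finset.card_union_le _ _).trans
    (Nat.add_le_add_left Finset.card_biUnion_le _))
  rw [Finset.card_univ, Fintype.card_fun] at h1
  have h2 : 2 * (∑ i : κ, ({s : κ → V | s i ∈ R} : Finset (κ → V)).card)
      ≤ Fintype.card V ^ Fintype.card κ := by
    refine Nat.le_of_mul_le_mul_right ?_ hpos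
    rw [mul_assoc, Finset.sum_mul, Finset.sum_congr rfl fun i _ ↦ card_filter_apply_mem R i,
      Finset.sum_const, Finset.card_univ, smul_eq_mul, mul_comm (_ ^ _)]
    calc 2 * (Fintype.card κ * (R.ncard * Fintype.card V ^ Fintype.card κ))
        = 2 * Fintype.card κ * R.ncard * Fintype.card V ^ Fintype.card κ := by ring
      _ ≤ _ := Nat.mul_le_mul_right _ hR
  lia

/-- Exchange the two coordinates of `u i` for those `i` with `σ i = true`. -/
def swapAt {κ V : Type*} (σ : κ → Bool) (u : κ → V × V) : κ → V × V :=
  fun i ↦ if σ i then (u i).swap else u i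

theorem swapAt_involutive {κ V : Type*} (σ : κ → Bool) :
    Function.Involutive (swapAt (V := V) σ) := by
  intro u
  ext i <;> by_cases h : σ i <;> simp [swapAt, h]

/-- At least `p` first coordinates of `u` and no second coordinate of `u` lie in `R`. -/
def IsLopsided {κ V : Type*} (R : Set V) (p : ℕ) (u : κ → V × V) : Prop :=
  p ≤ {i | (u i).1 ∈ R}.ncard ∧ ∀ i, (u i).2 ∉ R

open Classical in
/-- Few of the swaps of `u` are lopsided for a given set. -/
theorem card_isLopsided_swapAt_le {κ V : Type*} [Fintype κ] (u : κ → V × V) (R : Set V) (p : ℕ) :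
    2 ^ p * ({σ | IsLopsided R p (swapAt σ u)} : Finset (κ → Bool)).card
      ≤ 2 ^ Fintype.card κ := by
  set S : Finset (κ → Bool) := {σ | IsLopsided R p (swapAt σ u)} with hS
  rcases S.eq_empty_or_nonempty with h0 | ⟨σ₀, hσ₀⟩
  · simp [h0]
  set Q : Finset κ := {i | (swapAt σ₀ u i).1 ∈ R} with hQ
  have hpQ : p ≤ Q.card := by
    have := (Finset.mem_filter.1 hσ₀).2.1
    rwa [Set.ncard_eq_toFinset_card', Set.toFinset_ofPred] at this
  have hagree : ∀ σ ∈ S, ∀ i ∈ Q, σ i = σ₀ i := by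
    intro σ hσ i hi
    have h1 := (Finset.mem_filter.1 hσ).2.2 i
    have h2 := (Finset.mem_filter.1 hi).2
    cases hs : σ i <;> cases hs' : σ₀ i <;> simp [swapAt, hs, hs'] at h1 h2 ⊢ <;>
      exact h1 h2
  have hle : S.card ≤ 2 ^ (Fintype.card κ - Q.card) := by
    have : S.card ≤ (Finset.univ : Finset ((Qᶜ : Finset κ) → Bool)).card := by
      refine Finset.card_le_card_of_injOn (fun σ i ↦ σ i) (fun _ _ ↦ Finset.mem_univ _) ?_
      intro σ hσ τ hτ hστ
      funext i
      by_cases hi : i ∈ Q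
      · rw [hagree σ hσ i hi, hagree τ hτ i hi]
      · exact congrFun hστ ⟨i, by simpa using hi⟩
    simpa [Finset.card_compl] using this
  calc 2 ^ p * S.card ≤ 2 ^ Q.card * 2 ^ (Fintype.card κ - Q.card) :=
        Nat.mul_le_mul (Nat.pow_le_pow_right two_pos hpQ) hle
    _ = 2 ^ Fintype.card κ := by
        rw [← pow_add, Nat.add_sub_cancel' (Finset.card_le_univ Q)]

open Classical in
/-- Few of the swaps of `u` are lopsided for some member of a family with few traces. -/
theorem card_exists_isLopsided_swapAt_le {κ V ι : Type*} [Fintype κ] (R : ι → Set V) (p : ℕ)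
    (u : κ → V × V) :
    2 ^ p * ({σ | ∃ b, IsLopsided (R b) p (swapAt σ u)} : Finset (κ → Bool)).card
      ≤ (Set.range fun b ↦ Sum.elim (fun i ↦ (u i).1) (fun i ↦ (u i).2) ⁻¹' R b).ncard
        * 2 ^ Fintype.card κ := by
  rcases isEmpty_or_nonempty ι with hι | hι
  · simp
  set w : κ ⊕ κ → V := Sum.elim (fun i ↦ (u i).1) (fun i ↦ (u i).2) with hw
  have hfin : (Set.range fun b ↦ w ⁻¹' R b).Finite := Set.toFinite _
  have hrep : ∀ T ∈ hfin.toFinset, ∃ b, w ⁻¹' R b = T := by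
    intro T hT; simpa using hT
  choose! f hf using hrep
  have hmem : ∀ b σ i, ((swapAt σ u i).1 ∈ R b ↔
        (if σ i then Sum.inr i else Sum.inl i) ∈ w ⁻¹' R b) ∧
      ((swapAt σ u i).2 ∈ R b ↔ (if σ i then Sum.inl i else Sum.inr i) ∈ w ⁻¹' R b) := by
    intro b σ i
    by_cases h : σ i <;> simp [swapAt, h, w]
  have hsub : ({σ | ∃ b, IsLopsided (R b) p (swapAt σ u)} : Finset (κ → Bool)) ⊆
      hfin.toFinset.biUnion fun T ↦ {σ | IsLopsided (R (f T)) p (swapAt σ u)} := by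
    intro σ hσ
    obtain ⟨b, hb⟩ := (Finset.mem_filter.1 hσ).2
    have hT : w ⁻¹' R b ∈ hfin.toFinset := by simp
    refine Finset.mem_biUnion.2 ⟨_, hT, Finset.mem_filter.2 ⟨Finset.mem_univ _, ?_⟩⟩
    simp only [IsLopsided, (hmem _ σ _).1, (hmem _ σ _).2] at hb ⊢
    rwa [hf _ hT]
  calc _ ≤ 2 ^ p * ∑ T ∈ hfin.toFinset,
          ({σ | IsLopsided (R (f T)) p (swapAt σ u)} : Finset (κ → Bool)).card :=
        Nat.mul_le_mul_left _ ((Finset.card_le_card hsub).trans Finset.card_biUnion_le)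
    _ = ∑ T ∈ hfin.toFinset,
          2 ^ p * ({σ | IsLopsided (R (f T)) p (swapAt σ u)} : Finset (κ → Bool)).card :=
        Finset.mul_sum _ _ _
    _ ≤ ∑ T ∈ hfin.toFinset, 2 ^ Fintype.card κ :=
        Finset.sum_le_sum fun T _ ↦ card_isLopsided_swapAt_le u _ p
    _ = _ := by rw [Finset.sum_const, smul_eq_mul, Set.ncard_eq_toFinset_card _ hfin]

open Classical in
/-- If every `n`-tuple meets some member of a family of sets of density at most `1 / (2 * n)` at
least `p` times, then at least half of the pairs of `n`-tuples are lopsided for some member. -/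
theorem card_pow_mul_card_pow_le {κ V ι : Type*} [Fintype κ] [Fintype V] (R : ι → Set V) (p : ℕ)
    (hR : ∀ a, 2 * Fintype.card κ * (R a).ncard ≤ Fintype.card V)
    (h : ∀ s : κ → V, ∃ a, p ≤ {i | s i ∈ R a}.ncard) :
    Fintype.card V ^ Fintype.card κ * Fintype.card V ^ Fintype.card κ
      ≤ 2 * ({u | ∃ b, IsLopsided (R b) p u} : Finset (κ → V × V)).card := by
  choose a ha using h
  have hcard : (Finset.univ.sigma fun s : κ → V ↦
      ({s' : κ → V | ∀ i, s' i ∉ R (a s)} : Finset (κ → V))).card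
        ≤ ({u | ∃ b, IsLopsided (R b) p u} : Finset (κ → V × V)).card := by
    refine Finset.card_le_card_of_injOn (fun x i ↦ (x.1 i, x.2 i)) ?_ ?_
    · rintro ⟨s, s'⟩ h
      have h : ∀ i, s' i ∉ R (a s) := by simpa using h
      simp only [Finset.coe_filter, Finset.mem_univ, true_and, Set.mem_ofPred_eq]
      exact ⟨a s, ha s, h⟩
    · rintro ⟨s, s'⟩ - ⟨t, t'⟩ - h
      have h' := fun i ↦ Prod.ext_iff.1 (congrFun h i)
      obtain rfl : s = t := funext fun i ↦ (h' i).1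
      obtain rfl : s' = t' := funext fun i ↦ (h' i).2
      rfl
  refine le_trans ?_ (Nat.mul_le_mul_left 2 hcard)
  rw [Finset.card_sigma, Finset.mul_sum]
  calc _ = ∑ _s : κ → V, Fintype.card V ^ Fintype.card κ := by simp
    _ ≤ _ := Finset.sum_le_sum fun s _ ↦ card_pow_le_two_mul_card_avoiding _ (hR (a s))

open Classical in
theorem sum_card_swapAt {κ V : Type*} [Fintype κ] [Fintype V] (E : (κ → V × V) → Prop) :
    ∑ u : κ → V × V, ({σ | E (swapAt σ u)} : Finset (κ → Bool)).card
      = 2 ^ Fintype.card κ * ({u | E u} : Finset (κ → V × V)).card := by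
  calc _ = ∑ σ : κ → Bool, ({u | E (swapAt σ u)} : Finset (κ → V × V)).card := by
        simp only [Finset.card_filter]
        exact Finset.sum_comm
    _ = ∑ σ : κ → Bool, ({u | E u} : Finset (κ → V × V)).card := by
        refine Finset.sum_congr rfl fun σ _ ↦ ?_
        refine Finset.card_bij (fun u _ ↦ swapAt σ u) ?_ ?_ ?_
        · intro u hu; simpa using hu
        · intro u _ u' _ h; exact (swapAt_involutive σ).injective h
        · intro u hu
          refine ⟨swapAt σ u, ?_, swapAt_involutive σ u⟩
          simpa [(swapAt_involutive σ) u] using hu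
    _ = _ := by simp

/-- If all members of a family with few traces on `2 * n` points have density at most
`1 / (2 * n)`, then some `n`-tuple meets every member of the family fewer than `p` times. -/
theorem exists_sample {κ V ι : Type*} [Fintype κ] [Fintype V] [Nonempty V]
    (R : ι → Set V) (p : ℕ) (hR : ∀ a, 2 * Fintype.card κ * (R a).ncard ≤ Fintype.card V)
    (htr : ∀ u : κ ⊕ κ → V, 2 * (Set.range fun a ↦ u ⁻¹' R a).ncard < 2 ^ p) :
    ∃ s : κ → V, ∀ a, {i | s i ∈ R a}.ncard < p := by
  classical
  by_contra! hcon
  have hlow := card_pow_mul_card_pow_le R p hR hcon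
  have hup : ∀ u : κ → V × V,
      2 * ({σ | ∃ b, IsLopsided (R b) p (swapAt σ u)} : Finset (κ → Bool)).card
        < 2 ^ Fintype.card κ := by
    intro u
    refine Nat.lt_of_mul_lt_mul_left (a := 2 ^ p) ?_
    rw [mul_left_comm]
    refine (Nat.mul_le_mul_left 2 (card_exists_isLopsided_swapAt_le R p u)).trans_lt ?_
    rw [← mul_assoc]
    exact Nat.mul_lt_mul_of_pos_right (htr _) (by positivity)
  have hlt := Finset.sum_lt_sum_of_nonempty Finset.univ_nonempty fun u _ ↦ hup u
  rw [← Finset.mul_sum, sum_card_swapAt fun u ↦ ∃ b, IsLopsided (R b) p u, Finset.sum_const,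
    Finset.card_univ, Fintype.card_fun, Fintype.card_prod, mul_pow, smul_eq_mul] at hlt
  have := Nat.mul_le_mul_left (2 ^ Fintype.card κ) hlow
  lia

theorem exists_mul_pow_lt_two_pow (K e : ℕ) : ∃ p : ℕ, 1 ≤ p ∧ K * p ^ e < 2 ^ p := by
  have h := (tendsto_pow_const_div_const_pow_of_one_lt e (r := 2) one_lt_two).const_mul (K : ℝ)
  rw [mul_zero] at h
  obtain ⟨p, hp, hp1⟩ := ((h.eventually (gt_mem_nhds one_pos)).and
    (Filter.eventually_ge_atTop 1)).exists
  refine ⟨p, hp1, ?_⟩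
  rw [← mul_div_assoc, div_lt_one (by positivity)] at hp
  exact_mod_cast hp

theorem two_mul_pow_le_succ_pow (L : ℕ) : 2 * L ^ (L + 1) ≤ (L + 1) ^ (L + 1) := by
  have h : L ^ (L + 1) + (L + 1) * L ^ L ≤ (L + 1) ^ (L + 1) := by
    simpa using pow_add_mul_le_add_pow_of_sq_nonneg (Nat.zero_le L) (Nat.zero_le (1 ^ 2))
      (Nat.zero_le _) (Nat.zero_le _) (L + 1)
  calc 2 * L ^ (L + 1) = L ^ (L + 1) + L * L ^ L := by ring
    _ ≤ L ^ (L + 1) + (L + 1) * L ^ L := by gcongr; lia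
    _ ≤ _ := h

theorem succ_pow_le_four_mul_pow (L : ℕ) : (L + 1) ^ L ≤ 4 * L ^ L := by
  rcases Nat.eq_zero_or_pos L with rfl | hL
  · simp
  have hL' : (0 : ℝ) < L := by exact_mod_cast hL
  have h1 : ((L : ℝ)⁻¹ + 1) ^ L ≤ Real.exp 1 := by
    calc ((L : ℝ)⁻¹ + 1) ^ L ≤ Real.exp (L : ℝ)⁻¹ ^ L :=
          pow_le_pow_left₀ (by positivity) (Real.add_one_le_exp _) _
      _ = Real.exp 1 := by rw [← Real.exp_nat_mul, mul_inv_cancel₀ hL'.ne']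
  have h2 : ((L : ℝ) + 1) ^ L = ((L : ℝ)⁻¹ + 1) ^ L * L ^ L := by
    rw [← mul_pow, add_mul, inv_mul_cancel₀ hL'.ne', one_mul, add_comm]
  have h3 : ((L : ℝ) + 1) ^ L ≤ 4 * L ^ L := by
    rw [h2]
    gcongr
    linarith [Real.exp_one_lt_d9]
  exact_mod_cast h3

/-- A weak form of the **ε-net theorem**: a bounded number of points hits every member of a
family of VC dimension at most `d` whose preimage in `V` has density larger than `1 / (L + 1)`. -/
theorem exists_net (d L : ℕ) : ∃ N : ℕ, ∀ {A V : Type u} [Fintype V] [Nonempty V]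
    (F : Set (Set A)) (f : V → A), VCDimLE F d →
    ∃ B : Finset A, B.card ≤ N ∧ ∀ E ∈ F, (∀ b ∈ B, b ∉ E) →
      (L + 1) * (f ⁻¹' E).ncard ≤ Fintype.card V := by
  classical
  obtain ⟨p, hp, hpK⟩ := exists_mul_pow_lt_two_pow (2 * (16 * (L + 1) + 1) ^ d) (2 * d)
  set r := (L + 1) * (4 * p) with hr
  refine ⟨2 * p * r, fun {A V} _ _ F f hF ↦ ?_⟩
  set v := Fintype.card V with hv
  let ι := {E : Set A // E ∈ F ∧ v < (L + 1) * (f ⁻¹' E).ncard}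
  let R : ι → Set (Fin r → V) := fun E ↦ {x | ∀ j, x j ∉ f ⁻¹' E.1}
  have hR : ∀ E, 2 * Fintype.card (Fin (2 * p)) * (R E).ncard ≤ Fintype.card (Fin r → V) := by
    rintro ⟨E, hE, hlarge⟩
    have hc : (R ⟨E, hE, hlarge⟩).ncard = ((f ⁻¹' E)ᶜ).ncard ^ r := by
      have : R ⟨E, hE, hlarge⟩ = Fintype.piFinset fun _ : Fin r ↦ ((f ⁻¹' E)ᶜ).toFinset := by
        ext x; simp [R]
      rw [this, Set.ncard_coe_finset, Fintype.card_piFinset]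
      simp [Set.ncard_eq_toFinset_card']
    have hcomp : (L + 1) * ((f ⁻¹' E)ᶜ).ncard ≤ L * v := by
      have := Set.ncard_add_ncard_compl (f ⁻¹' E)
      rw [Nat.card_eq_fintype_card] at this
      nlinarith
    have hpow : 4 * p * L ^ r ≤ (L + 1) ^ r := by
      have h1 := Nat.pow_le_pow_left (two_mul_pow_le_succ_pow L) (4 * p)
      rw [mul_pow, ← pow_mul, ← pow_mul] at h1
      exact (Nat.mul_le_mul_right _ Nat.lt_two_pow_self.le).trans h1
    rw [hc, Fintype.card_fin, Fintype.card_fun, Fintype.card_fin]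
    refine Nat.le_of_mul_le_mul_left (c := (L + 1) ^ r) ?_ (by positivity)
    calc (L + 1) ^ r * (2 * (2 * p) * ((f ⁻¹' E)ᶜ).ncard ^ r)
        = 4 * p * ((L + 1) * ((f ⁻¹' E)ᶜ).ncard) ^ r := by rw [mul_pow]; ring
      _ ≤ 4 * p * (L * v) ^ r := by gcongr
      _ = 4 * p * L ^ r * v ^ r := by rw [mul_pow]; ring
      _ ≤ (L + 1) ^ r * v ^ r := by gcongr
  have htr : ∀ u : Fin (2 * p) ⊕ Fin (2 * p) → (Fin r → V),
      2 * (Set.range fun E ↦ u ⁻¹' R E).ncard < 2 ^ p := by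
    intro u
    let w : (Fin (2 * p) ⊕ Fin (2 * p)) × Fin r → A := fun x ↦ f (u x.1 x.2)
    have hsub : (Set.range fun E ↦ u ⁻¹' R E) ⊆
        (fun T ↦ {i | ∀ j, (i, j) ∉ T}) '' ((fun E ↦ w ⁻¹' E) '' F) := by
      rintro _ ⟨E, rfl⟩
      exact ⟨_, ⟨E.1, E.2.1, rfl⟩, rfl⟩
    have h1 : (Set.range fun E ↦ u ⁻¹' R E).ncard ≤ (4 * p * r + 1) ^ d := by
      calc _ ≤ _ := Set.ncard_le_ncard hsub (Set.toFinite _)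
        _ ≤ _ := Set.ncard_image_le (Set.toFinite _)
        _ ≤ _ := hF.ncard_preimage_le w
        _ = _ := by
          simp only [Fintype.card_prod, Fintype.card_sum, Fintype.card_fin]
          ring
    have h2 : 4 * p * r + 1 ≤ (16 * (L + 1) + 1) * p ^ 2 := by
      rw [hr]; nlinarith
    calc _ ≤ 2 * ((16 * (L + 1) + 1) * p ^ 2) ^ d :=
          Nat.mul_le_mul_left _ (h1.trans (Nat.pow_le_pow_left h2 d))
      _ = 2 * (16 * (L + 1) + 1) ^ d * p ^ (2 * d) := by rw [mul_pow, ← pow_mul, mul_assoc]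
      _ < _ := hpK
  obtain ⟨s, hs⟩ := exists_sample R p hR htr
  refine ⟨Finset.univ.image fun x : Fin (2 * p) × Fin r ↦ f (s x.1 x.2),
    Finset.card_image_le.trans (by simp), fun E hE hB ↦ ?_⟩
  by_contra! hlarge
  have h1 := hs ⟨E, hE, hlarge⟩
  have h2 : {i | s i ∈ R ⟨E, hE, hlarge⟩} = Set.univ := by
    refine Set.eq_univ_of_forall fun i j hmem ↦ hB (f (s i j)) ?_ hmem
    exact Finset.mem_image_of_mem (fun x : Fin (2 * p) × Fin r ↦ f (s x.1 x.2))
      (Finset.mem_univ (i, j))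
  rw [h2, Set.ncard_univ, Nat.card_eq_fintype_card, Fintype.card_fin] at h1
  lia

/-- For every weight function on `A`, some `k`-isolated member of `F` differs from `Cstar` only on
a set of small weight, where `k` depends only on the VC dimension of `F` and the allowed error. -/
theorem exists_isIsolatedIn_weight_le (d L : ℕ) : ∃ k : ℕ, ∀ (A : Type u) [Fintype A] [Nonempty A]
    (F : Set (Set A)) (Cstar : Set A) [∀ C : Set A, DecidablePred (· ∈ symmDiff C Cstar)],
    VCDimLE F d → Cstar ∈ F → ∀ w : A → ℕ, (∀ a, 0 < w a) →
    ∃ C ∈ F, IsIsolatedIn F k C ∧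
      (L + 1) * ∑ a with a ∈ symmDiff C Cstar, w a ≤ ∑ a, w a := by
  obtain ⟨N, hN⟩ := exists_net.{u} d L
  obtain ⟨k, hk⟩ := exists_isIsolatedIn.{u} d
  refine ⟨N + k, fun A _ _ F Cstar _ hF hCstar w hw ↦ ?_⟩
  have : ∀ a, NeZero (w a) := fun a ↦ ⟨(hw a).ne'⟩
  have : Nonempty (Σ a, Fin (w a)) := ⟨⟨Classical.arbitrary A, 0⟩⟩
  obtain ⟨B, hB, hnet⟩ := hN _ (Sigma.fst : (Σ a, Fin (w a)) → A) (hF.symmDiff_right Cstar)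
  obtain ⟨C, hC, hiso⟩ := hk A {C ∈ F | ∀ b ∈ B, b ∈ C ↔ b ∈ Cstar}
    ⟨Cstar, hCstar, fun _ _ ↦ Iff.rfl⟩ (hF.mono (Set.sep_subset _ _))
  obtain ⟨A₀, hA₀, hA₀'⟩ := hiso.of_agreeing hC.2
  refine ⟨C, hC.1, ⟨A₀, by lia, hA₀'⟩, ?_⟩
  have h := hnet _ ⟨C, hC.1, rfl⟩ fun b hb hmem ↦ by
    have := hC.2 b hb
    rw [Set.mem_symmDiff] at hmem
    tauto
  have hcard : ((Sigma.fst : (Σ a, Fin (w a)) → A) ⁻¹' symmDiff C Cstar).ncard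
      = ∑ a with a ∈ symmDiff C Cstar, w a := by
    have : (Sigma.fst : (Σ a, Fin (w a)) → A) ⁻¹' symmDiff C Cstar =
        ((Finset.univ.filter (· ∈ symmDiff C Cstar)).sigma fun a ↦ (Finset.univ : Finset (Fin (w a))) :
          Finset (Σ a, Fin (w a))) := by
      ext x; simp
    rw [this, Set.ncard_coe_finset, Finset.card_sigma]
    simp
  rw [hcard] at h
  simpa using h

/-! ### Multiplicative weights -/

/-- If for every weight function some member of a collection has a small weight of errors, then
some sequence of members has a small exponential error. -/
theorem exists_sequence_sum_prod_le {A : Type*} [Fintype A] (P : Set A → Prop) (L : ℕ)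
    (Cstar : Set A) [∀ C : Set A, DecidablePred (· ∈ symmDiff C Cstar)]
    (hP : ∀ w : A → ℕ, (∀ a, 0 < w a) →
      ∃ C, P C ∧ L * ∑ a with a ∈ symmDiff C Cstar, w a ≤ ∑ a, w a) (N : ℕ) :
    ∃ C : Fin N → Set A, (∀ t, P (C t)) ∧
      L ^ N * ∑ a, ∏ t, (if a ∈ symmDiff (C t) Cstar then 2 else 1)
        ≤ Fintype.card A * (L + 1) ^ N := by
  induction N with
  | zero => exact ⟨Fin.elim0, fun t ↦ t.elim0, by simp⟩
  | succ N ih =>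
    obtain ⟨C, hC, hle⟩ := ih
    set w : A → ℕ := fun a ↦ ∏ t, (if a ∈ symmDiff (C t) Cstar then 2 else 1) with hw
    obtain ⟨D, hD, hDw⟩ := hP w fun a ↦ Finset.prod_pos fun t _ ↦ by split_ifs <;> simp
    refine ⟨Fin.cons D C, Fin.cases hD hC, ?_⟩
    have hsum : ∑ a, ∏ t, (if a ∈ symmDiff ((Fin.cons D C : Fin (N + 1) → Set A) t) Cstar
        then 2 else 1) = ∑ a, w a + ∑ a with a ∈ symmDiff D Cstar, w a := by
      rw [Finset.sum_filter, ← Finset.sum_add_distrib]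
      refine Finset.sum_congr rfl fun a _ ↦ ?_
      simp only [Fin.prod_univ_succ, Fin.cons_zero, Fin.cons_succ, hw]
      split_ifs <;> ring
    rw [hsum]
    calc L ^ (N + 1) * (∑ a, w a + ∑ a with a ∈ symmDiff D Cstar, w a)
        = L ^ N * (L * ∑ a, w a + L * ∑ a with a ∈ symmDiff D Cstar, w a) := by ring
      _ ≤ L ^ N * (L * ∑ a, w a + ∑ a, w a) := by gcongr
      _ = L ^ N * (∑ a, w a) * (L + 1) := by ring
      _ ≤ Fintype.card A * (L + 1) ^ N * (L + 1) := by gcongr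
      _ = _ := by ring

/-- If for every weight function some member of a collection has a small weight of errors, then
there is a sequence of members in which every point has few errors. -/
theorem exists_sequence_errors_le {A : Type*} [Fintype A] (P : Set A → Prop) {L : ℕ}
    (hL : 0 < L) (Cstar : Set A) [∀ C : Set A, DecidablePred (· ∈ symmDiff C Cstar)]
    (hP : ∀ w : A → ℕ, (∀ a, 0 < w a) →
      ∃ C, P C ∧ L * ∑ a with a ∈ symmDiff C Cstar, w a ≤ ∑ a, w a) :
    ∃ C : Fin (L * Fintype.card A) → Set A, (∀ t, P (C t)) ∧
      ∀ a, Finset.card {t | a ∈ symmDiff (C t) Cstar} ≤ 3 * Fintype.card A := by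
  set M := Fintype.card A
  obtain ⟨C, hC, hle⟩ := exists_sequence_sum_prod_le P L Cstar hP (L * M)
  refine ⟨C, hC, fun a ↦ ?_⟩
  have h1 : L ^ (L * M) * 2 ^ Finset.card {t | a ∈ symmDiff (C t) Cstar}
      ≤ L ^ (L * M) * 2 ^ (3 * M) := by
    calc _ = L ^ (L * M) * ∏ t, (if a ∈ symmDiff (C t) Cstar then 2 else 1) := by
          rw [Finset.prod_ite]; simp
      _ ≤ L ^ (L * M) * ∑ a, ∏ t, (if a ∈ symmDiff (C t) Cstar then 2 else 1) :=
          Nat.mul_le_mul_left _ (Finset.single_le_sum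
            (f := fun a ↦ ∏ t, (if a ∈ symmDiff (C t) Cstar then 2 else 1))
            (fun _ _ ↦ Nat.zero_le _) (Finset.mem_univ a))
      _ ≤ M * (L + 1) ^ (L * M) := hle
      _ = M * ((L + 1) ^ L) ^ M := by rw [pow_mul]
      _ ≤ 2 ^ M * (4 * L ^ L) ^ M := by
          gcongr
          · exact Nat.lt_two_pow_self.le
          · exact succ_pow_le_four_mul_pow L
      _ = L ^ (L * M) * 2 ^ (3 * M) := by
          rw [mul_pow, ← pow_mul, ← mul_assoc, ← mul_pow, pow_mul 2 3 M, mul_comm]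
          norm_num
  exact (Nat.pow_le_pow_iff_right one_lt_two).1
    (Nat.le_of_mul_le_mul_left h1 (by positivity))

/-- For every `d` there are `J = J(d)` and `k = k(d)` such that for every finite
nonempty set `A`, every nonempty family `𝓒` of subsets of `A` of VC dimension at most
`d`, and every `C* ∈ 𝓒`, there are `1 ≤ m ≤ J` and `C_0, …, C_{m-1} ∈ 𝓒`, each
`k`-isolated in `𝓒`, such that membership of each `a ∈ A` in `C*` agrees with the
majority vote of the memberships of `a` in `C_0, …, C_{m-1}`. -/
theorem exists_majority_of_isolated (d : ℕ) :
    ∃ J k : ℕ, ∀ (A : Type*) [Fintype A] [Nonempty A]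
      (𝓒 : Set (Set A)) (Cstar : Set A),
      𝓒.Nonempty → VCDimLE 𝓒 d → Cstar ∈ 𝓒 →
      ∃ m : ℕ, 1 ≤ m ∧ m ≤ J ∧
        ∃ C : Fin m → Set A,
          (∀ t, C t ∈ 𝓒) ∧
          (∀ t, ∃ A₀ : Finset A, A₀.card ≤ k ∧
            ∀ C' ∈ 𝓒, C' ∩ ↑A₀ = C t ∩ ↑A₀ → C' = C t) ∧
          ∀ a : A, m < 2 * Set.ncard {t : Fin m | a ∈ Cstar ↔ a ∈ C t} := by
  classical
  obtain ⟨p, hp, hpK⟩ := exists_mul_pow_lt_two_pow (2 * 5 ^ 2 ^ (d + 1)) (2 ^ (d + 1))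
  obtain ⟨k, hk⟩ := exists_isIsolatedIn_weight_le d (12 * p - 1)
  refine ⟨2 * p, k, fun A _ _ 𝓒 Cstar _ hvc hCstar ↦ ⟨2 * p, by lia, le_rfl, ?_⟩⟩
  obtain ⟨C, hC, herr⟩ := exists_sequence_errors_le (fun C ↦ C ∈ 𝓒 ∧ IsIsolatedIn 𝓒 k C)
    (L := 12 * p) (by lia) Cstar fun w hw ↦ by
      obtain ⟨C, hC, hiso, hle⟩ := hk A 𝓒 Cstar hvc hCstar w hw
      rw [Nat.sub_add_cancel (by lia)] at hle
      exact ⟨C, ⟨hC, hiso⟩, hle⟩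
  have : NeZero (12 * p * Fintype.card A) := ⟨by positivity⟩
  obtain ⟨s, hs⟩ := exists_sample (κ := Fin (2 * p)) (fun a ↦ {t | a ∈ symmDiff (C t) Cstar}) p
    (fun a ↦ by
      have := herr a
      rw [Set.ncard_eq_toFinset_card', Set.toFinset_ofPred, Fintype.card_fin, Fintype.card_fin]
      nlinarith)
    (fun u ↦ by
      have hD := ((hvc.symmDiff_right Cstar).dual (fun t ↦ symmDiff (C t) Cstar)
        fun t ↦ ⟨C t, (hC t).1, rfl⟩).ncard_preimage_le u
      rw [← Set.range_comp] at hD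
      simp only [Fintype.card_sum, Fintype.card_fin] at hD
      calc _ ≤ 2 * (2 * p + 2 * p + 1) ^ 2 ^ (d + 1) := Nat.mul_le_mul_left 2 hD
        _ ≤ 2 * (5 * p) ^ 2 ^ (d + 1) := by gcongr; lia
        _ = 2 * 5 ^ 2 ^ (d + 1) * p ^ 2 ^ (d + 1) := by rw [mul_pow, mul_assoc]
        _ < _ := hpK)
  refine ⟨fun i ↦ C (s i), fun i ↦ (hC _).1, fun i ↦ (hC _).2, fun a ↦ ?_⟩
  have h1 := hs a
  have h2 : {i | s i ∈ {t | a ∈ symmDiff (C t) Cstar}} = {i | a ∈ Cstar ↔ a ∈ C (s i)}ᶜ := by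
    ext i
    simp only [Set.mem_symmDiff, Set.mem_ofPred_eq, Set.mem_compl_iff]
    tauto
  rw [h2] at h1
  have h3 := Set.ncard_add_ncard_compl {i | a ∈ Cstar ↔ a ∈ C (s i)}
  rw [Nat.card_eq_fintype_card, Fintype.card_fin] at h3
  lia
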